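/- In an ado-semilattice (S,⊔,∩), with x ≲ y meaning y⊔x = y and a⋎b defined as (a⊔b)∩(b⊔a), the following two quasiequations hold for all a,b,c,d ∈ S: (1) if d ≲ a∩b and d ≲ b∩c then d ≲ a∩c; (2) if d ≲ a, d ≲ b and d ≲ a⋎b then d ≲ a∩b. -/

import Mathlib

/-- An ado-semilattice: `(S,∩)` is a meet-semilattice; with `x ≤ y` meaning
`x∩y = x`, the four o-semilattice laws hold; `⊔` is associative; and the
distributivity law holds. -/
structure IsAdo {S : Type*} (inter ov : S → S → S) : Prop where
  inter_comm : ∀ a b, inter a b = inter b a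
  inter_assoc : ∀ a b c, inter (inter a b) c = inter a (inter b c)
  inter_idem : ∀ a, inter a a = a
  le1 : ∀ x y, inter x (ov x y) = x
  le2 : ∀ x y z, inter (ov (inter x y) (inter y z)) y = ov (inter x y) (inter y z)
  le3 : ∀ x y, inter (ov x y) (ov x (inter y (ov x y))) = ov x y
  le4 : ∀ x y z, inter (inter x z) (ov (inter x y) z) = inter x z
  ov_assoc : ∀ x y z, ov (ov x y) z = ov x (ov y z)
  distrib : ∀ a b c d,
    ov (inter a d) (inter (inter b d) (inter c d)) =
      inter (ov (inter a d) (inter b d)) (ov (inter a d) (inter c d))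

namespace IsAdo

theorem le_trans {S : Type*} {inter ov : S → S → S} (h : IsAdo inter ov) {x y z : S}
    (hxy : inter x y = x) (hyz : inter y z = y) : inter x z = x := by
  rw [← hxy, h.inter_assoc, hyz]

theorem le_antisymm {S : Type*} {inter ov : S → S → S} (h : IsAdo inter ov) {x y : S}
    (hxy : inter x y = x) (hyx : inter y x = y) : x = y := by
  rw [← hxy, h.inter_comm, hyx]

theorem inter_le_left {S : Type*} {inter ov : S → S → S} (h : IsAdo inter ov) (x y : S) :
    inter (inter x y) x = inter x y := by
  rw [h.inter_comm, ← h.inter_assoc, h.inter_idem]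

theorem inter_le_right {S : Type*} {inter ov : S → S → S} (h : IsAdo inter ov) (x y : S) :
    inter (inter x y) y = inter x y := by
  rw [h.inter_assoc, h.inter_idem]

theorem le_inter {S : Type*} {inter ov : S → S → S} (h : IsAdo inter ov) {x y z : S}
    (hy : inter x y = x) (hz : inter x z = x) : inter x (inter y z) = x := by
  rw [← h.inter_assoc, hy, hz]

theorem ov_le {S : Type*} {inter ov : S → S → S} (h : IsAdo inter ov) {x y u : S}
    (hx : inter x u = x) (hy : inter y u = y) : inter (ov x y) u = ov x y := by
  have := h.le2 x u y
  rwa [hx, h.inter_comm u y, hy] at this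

theorem le_ov_right {S : Type*} {inter ov : S → S → S} (h : IsAdo inter ov) {x y u : S}
    (hx : inter x u = x) (hy : inter y u = y) : inter y (ov x y) = y := by
  have := h.le4 u x y
  rwa [h.inter_comm u x, hx, h.inter_comm u y, hy] at this

theorem ov_eq_left_of_le {S : Type*} {inter ov : S → S → S} (h : IsAdo inter ov) {x y : S}
    (hxy : inter x y = x) : ov y x = y :=
  h.le_antisymm (h.ov_le (h.inter_idem y) hxy) (h.le1 y x)

theorem ov_ov_self {S : Type*} {inter ov : S → S → S} (h : IsAdo inter ov) (x y : S) :
    ov x (ov y x) = ov x y := by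
  rw [← h.ov_assoc, h.ov_eq_left_of_le (h.le1 x y)]

/-- Under a common upper bound, domain inclusion implies inclusion. -/
theorem le_of_ov_eq {S : Type*} {inter ov : S → S → S} (h : IsAdo inter ov) {x y u : S}
    (hx : inter x u = x) (hy : inter y u = y) (hyx : ov y x = y) : inter x y = x := by
  have := h.le_ov_right hy hx
  rwa [hyx] at this

theorem ov_eq_left_of_le_of_ov_eq {S : Type*} {inter ov : S → S → S} (h : IsAdo inter ov)
    {x y d : S} (hxy : inter x y = x) (hd : ov x d = x) : ov y d = y := by
  have hy := h.ov_eq_left_of_le hxy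
  rw [← hy, h.ov_assoc, hd]

/-- If `p` and `q` are bounded above and their domains both contain that of `d`, then
overriding `p` by `(p ∩ q) ⊔ d` does not change `p`. -/
theorem ov_ov_inter_eq {S : Type*} {inter ov : S → S → S} (h : IsAdo inter ov)
    {p q b d : S} (hp : inter p b = p) (hq : inter q b = q)
    (hpd : ov p d = p) (hqd : ov q d = q) : ov (ov (inter p q) d) p = p := by
  have hrp := h.inter_le_left p q
  have hrq := h.inter_le_right p q
  set r := inter p q with hr
  set w := ov r d with hw
  set P := ov w p with hP
  set p' := inter p P with hp'
  have hwP : ov w p' = P := by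
    refine h.le_antisymm ?_ (h.le3 w p)
    exact h.ov_le (h.le1 w p) (h.inter_le_right p P)
  have hrp' : inter r p' = r :=
    h.le_inter hrp (h.le_trans (h.le1 r d) (h.le1 w p))
  have hp'p : inter p' p = p' := h.inter_le_left p P
  have hp'b := h.le_trans hp'p hp
  have hqw : ov q w = q := by
    rw [hw, ← h.ov_assoc, h.ov_eq_left_of_le hrq, hqd]
  have hpw : ov p w = p := by
    rw [hw, ← h.ov_assoc, h.ov_eq_left_of_le hrp, hpd]
  have hcover : ov (ov p' q) p = ov p' q := by
    calc ov (ov p' q) p = ov p' (ov (ov q w) p) := by rw [hqw, h.ov_assoc]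
      _ = ov p' (ov q (ov w p')) := by rw [h.ov_assoc q, ← hP, hwP]
      _ = ov p' (ov (ov q w) p') := by rw [h.ov_assoc q]
      _ = ov p' q := by rw [hqw, h.ov_ov_self]
  have hple : inter p (ov p' q) = p := h.le_of_ov_eq hp (h.ov_le hp'b hq) hcover
  have hpp' : p = p' := by
    have hd := h.distrib p' p q b
    rw [hp'b, hp, hq, ← hr, h.ov_eq_left_of_le hrp'] at hd
    have hjoin : ov p' p = p :=
      h.le_antisymm (h.ov_le hp'p (h.inter_idem p)) (h.le_ov_right hp'p (h.inter_idem p))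
    rw [hjoin, hple] at hd
    exact hd.symm
  have hpP : inter p P = p := hpp'.symm
  have hpPov : ov p P = p := by rw [hP, h.ov_ov_self, hpw]
  exact h.le_antisymm (h.le_of_ov_eq (h.inter_idem P) hpP hpPov) hpP

theorem inter_ov_eq_of_bounded {S : Type*} {inter ov : S → S → S} (h : IsAdo inter ov)
    {p q b d : S} (hp : inter p b = p) (hq : inter q b = q)
    (hpd : ov p d = p) (hqd : ov q d = q) : ov (inter p q) d = inter p q := by
  have h₁ := h.le1 (ov (inter p q) d) p
  rw [h.ov_ov_inter_eq hp hq hpd hqd] at h₁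
  have h₂ := h.le1 (ov (inter q p) d) q
  rw [h.ov_ov_inter_eq hq hp hqd hpd, h.inter_comm q p] at h₂
  exact h.le_antisymm (h.le_inter h₁ h₂) (h.le1 _ _)

theorem inter_ov_eq_trans {S : Type*} {inter ov : S → S → S} (h : IsAdo inter ov)
    {a b c d : S} (hab : ov (inter a b) d = inter a b) (hbc : ov (inter b c) d = inter b c) :
    ov (inter a c) d = inter a c := by
  refine h.ov_eq_left_of_le_of_ov_eq ?_ (h.inter_ov_eq_of_bounded (h.inter_le_right a b)
    (h.inter_le_left b c) hab hbc)
  exact h.le_inter (h.le_trans (h.inter_le_left _ _) (h.inter_le_left a b))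
    (h.le_trans (h.inter_le_right _ _) (h.inter_le_right b c))

end IsAdo

/-- In an ado-semilattice, with `x ≲ y` meaning `y⊔x = y` and
`a⋎b := (a⊔b)∩(b⊔a)`: (1) `d ≲ a∩b` and `d ≲ b∩c` imply `d ≲ a∩c`;
(2) `d ≲ a`, `d ≲ b` and `d ≲ a⋎b` imply `d ≲ a∩b`. -/
theorem stmt_9 {S : Type*} (inter ov : S → S → S) (h : IsAdo inter ov) :
    (∀ a b c d, ov (inter a b) d = inter a b → ov (inter b c) d = inter b c →
      ov (inter a c) d = inter a c) ∧
    (∀ a b d, ov a d = a → ov b d = b →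
      ov (inter (ov a b) (ov b a)) d = inter (ov a b) (ov b a) →
      ov (inter a b) d = inter a b) := by
  refine ⟨fun a b c d => h.inter_ov_eq_trans, fun a b d ha hb hm => ?_⟩
  have hat : ov (inter a (ov b a)) d = inter a (ov b a) :=
    h.inter_ov_eq_trans (b := ov a b) (by rwa [h.le1]) hm
  exact h.inter_ov_eq_trans (b := ov b a) hat (by rwa [h.inter_comm, h.le1])
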